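/- arXiv:math/0208123 — 2 statements merged into one kernel-verified Lean document; each statement's English description precedes it below -/
import Mathlib

section
/- Let (M_t)_{t≥0} be a peeling Markov chain started from 0, and fix an integer n ≥ 0. Then the number of visits to n, i.e. the cardinality of {t ≥ 0 : M_t = n}, is almost surely finite and at least 1, and is a geometric random variable on {1, 2, 3, …} with mean μ_n = ((3n+3)/(2n+3)) · (n+3/2)_{n+1} / (n+1)!, where (n+3/2)_{n+1} = (n+3/2)(n+1/2)···(3/2) = Γ(n+5/2)/Γ(3/2); that is, for every integer j ≥ 1, P(|{t : M_t = n}| = j) = (1/μ_n)(1 − 1/μ_n)^{j−1}. -/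
open Filter MeasureTheory ProbabilityTheory

/-- `p_{-1,m} = (2m+3)/(3m+3)`, the probability that the peeling step from boundary
size `m` adds a new vertex. -/
noncomputable def pMinusOne (m : ℕ) : ℝ := (2 * (m : ℝ) + 3) / (3 * (m : ℝ) + 3)

/-- `p_{k,m} = 2 (2k-2)! m!² (2m-2k+1)! / ((k-1)!(k+1)!(m-k)!²(2m+1)!)`, the probability
that the peeling step from boundary size `m` swallows `k` boundary vertices (`1 ≤ k ≤ m`). -/
noncomputable def pStep (k m : ℕ) : ℝ :=
  2 * ((2 * k - 2).factorial : ℝ) * ((m.factorial : ℝ)) ^ 2 *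
      ((2 * m - 2 * k + 1).factorial : ℝ) /
    (((k - 1).factorial : ℝ) * ((k + 1).factorial : ℝ) * (((m - k).factorial : ℝ)) ^ 2 *
      ((2 * m + 1).factorial : ℝ))

/-- The one-step transition probability of the peeling Markov chain: from state `m`
the chain moves to `m+1` with probability `p_{-1,m}`, and to `m-k` with probability
`p_{k,m}` for `1 ≤ k ≤ m`. -/
noncomputable def peelTransition (m j : ℕ) : ℝ :=
  if j = m + 1 then pMinusOne m
  else if j < m then pStep (m - j) m
  else 0

/-- `(M_t)_{t≥0}` is a peeling Markov chain w.r.t. the probability measure `P`: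
each `M t` is measurable, and conditionally on any initial trajectory
`(M_0,…,M_t) = (h 0,…,h t)` of positive probability, `M_{t+1} = j` with
probability `peelTransition (h t) j`. -/
def IsPeelingChain {Ω : Type*} [MeasurableSpace Ω] (P : Measure Ω) (M : ℕ → Ω → ℕ) : Prop :=
  (∀ t, Measurable (M t)) ∧
  ∀ (t : ℕ) (h : ℕ → ℕ),
    P {ω | ∀ i ≤ t, M i ω = h i} ≠ 0 →
    ∀ j : ℕ,
      (P[|{ω | ∀ i ≤ t, M i ω = h i}]) {ω | M (t + 1) ω = j} =
        ENNReal.ofReal (peelTransition (h t) j)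

/-- The descending factorial `(x)_k = x(x-1)⋯(x-k+1) = Γ(x+1)/Γ(x-k+1)`. -/
noncomputable def descFact (x : ℝ) (k : ℕ) : ℝ := ∏ i ∈ Finset.range k, (x - i)

/-- `μ_n = ((3n+3)/(2n+3)) (n+3/2)_{n+1} / (n+1)!`, the mean number of visits to `n`. -/
noncomputable def visitMean (n : ℕ) : ℝ :=
  (3 * (n : ℝ) + 3) / (2 * (n : ℝ) + 3) * descFact ((n : ℝ) + 3 / 2) (n + 1) /
    ((n + 1).factorial : ℝ)

open scoped ENNReal Topology

/-- The event `A` depends only on `M_0, …, M_t`. -/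
def Dep {Ω : Type*} (M : ℕ → Ω → ℕ) (t : ℕ) (A : Set Ω) : Prop :=
  ∀ ω ω', (∀ i ≤ t, M i ω = M i ω') → ω ∈ A → ω' ∈ A

/-- The transition operator. -/
noncomputable def Kop (v : ℕ → ℝ≥0∞) (m : ℕ) : ℝ≥0∞ :=
  ∑' j, v j * ENNReal.ofReal (peelTransition m j)

/-- The harmonic function of the underlying random walk. -/
noncomputable def hh (m : ℕ) : ℝ :=
  ((2 * m + 1).factorial : ℝ) / ((m.factorial : ℝ) ^ 2 * 4 ^ m)

lemma hh_pos (m : ℕ) : 0 < hh m := by unfold hh; positivity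

lemma hh_succ (m : ℕ) : hh (m + 1) = hh m * ((2 * m + 3) / (2 * m + 2)) := by
  unfold hh
  rw [show 2 * (m + 1) + 1 = (2 * m + 1) + 1 + 1 by ring, Nat.factorial_succ (2 * m + 1 + 1),
    Nat.factorial_succ (2 * m + 1), Nat.factorial_succ m]
  have := Nat.factorial_ne_zero m
  push_cast
  field_simp
  ring

lemma hh_zero : hh 0 = 1 := by simp [hh]

lemma hh_mono : Monotone hh := by
  apply monotone_nat_of_le_succ
  intro m
  rw [hh_succ]
  apply le_mul_of_one_le_right (hh_pos m).le
  rw [one_le_div (by positivity)]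
  linarith

lemma descFact_eq (n : ℕ) :
    descFact ((n : ℝ) + 3 / 2) (n + 1) / ((n + 1).factorial : ℝ) = hh (n + 1) := by
  induction n with
  | zero => rw [hh_succ, hh_zero]; simp [descFact]
  | succ n ih =>
    rw [hh_succ, ← ih]
    unfold descFact
    rw [Finset.prod_range_succ', Nat.factorial_succ (n + 1)]
    have : ∀ k : ℕ, ((n + 1 : ℕ) : ℝ) + 3 / 2 - ((k + 1 : ℕ) : ℝ) = (n : ℝ) + 3 / 2 - k := by
      intro k; push_cast; ring
    simp only [this]
    have h2 := Nat.factorial_ne_zero (n + 1)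
    push_cast
    field_simp
    ring

lemma visitMean_inv (n : ℕ) : 1 / visitMean n = pMinusOne n / hh (n + 1) := by
  unfold visitMean pMinusOne
  rw [mul_div_assoc, descFact_eq]
  have := (hh_pos (n + 1)).ne'
  field_simp

lemma pStep_add (k m a : ℕ) (hk : k ≤ m) :
    pStep k (m + a) * hh (m + a) / hh (m - k + a) = pStep k m * hh m / hh (m - k) := by
  have key : ∀ m, k ≤ m → pStep k m * hh m / hh (m - k) =
      2 * ((2 * k - 2).factorial : ℝ) / (((k - 1).factorial : ℝ) * ((k + 1).factorial : ℝ) * 4 ^ k) := by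
    intro m hm
    obtain ⟨l, rfl⟩ := Nat.exists_eq_add_of_le hm
    unfold pStep hh
    rw [show k + l - k = l by omega, show 2 * (k + l) - 2 * k + 1 = 2 * l + 1 by omega, pow_add]
    have h1 := Nat.factorial_ne_zero (k + l)
    have h2 := Nat.factorial_ne_zero l
    have h3 := Nat.factorial_ne_zero (2 * l + 1)
    have h4 := Nat.factorial_ne_zero (2 * (k + l) + 1)
    have h5 := Nat.factorial_ne_zero (k - 1)
    have h6 := Nat.factorial_ne_zero (k + 1)
    field_simp
  rw [key m hk, ← key (m + a) (by omega), show m + a - k = m - k + a by omega]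

lemma peelTransition_shift (l i a : ℕ) :
    peelTransition (l + a) (i + a) * hh (l + a) / hh (i + a) = peelTransition l i * hh l / hh i := by
  unfold peelTransition
  by_cases h1 : i = l + 1
  · subst h1
    rw [if_pos (by omega), if_pos rfl]
    rw [show l + 1 + a = l + a + 1 by omega, hh_succ, hh_succ]
    have e1 := (hh_pos l).ne'
    have e2 := (hh_pos (l + a)).ne'
    unfold pMinusOne
    push_cast
    field_simp
  · by_cases h2 : i < l
    · rw [if_neg (by omega), if_pos (by omega), if_neg h1, if_pos h2]
      have := pStep_add (l - i) l a (by omega)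
      rw [show l - (l - i) = i by omega] at this
      rwa [show l + a - (i + a) = l - i by omega]
    · rw [if_neg (by omega), if_neg (by omega), if_neg h1, if_neg h2]
      simp

lemma peelTransition_nonneg (m j : ℕ) : 0 ≤ peelTransition m j := by
  unfold peelTransition pMinusOne pStep
  split_ifs <;> positivity

/-- The probability, from `m`, of never being at `n`. -/
noncomputable def uu (n m : ℕ) : ℝ := if n < m then hh (m - n - 1) / hh m else 0

lemma uu_nonneg (n m : ℕ) : 0 ≤ uu n m := by
  unfold uu
  split_ifs
  · exact div_nonneg (hh_pos _).le (hh_pos _).le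
  · exact le_rfl

lemma uu_le_one (n m : ℕ) : uu n m ≤ 1 := by
  unfold uu
  split_ifs
  · rw [div_le_one (hh_pos _)]
    exact hh_mono (by omega)
  · exact zero_le_one

lemma uu_self (n : ℕ) : uu n n = 0 := by simp [uu]

lemma uu_tendsto (n : ℕ) : Tendsto (uu n) atTop (𝓝 1) := by
  have hr : Tendsto (fun l : ℕ => hh l / hh (l + 1)) atTop (𝓝 1) := by
    have h1 : Tendsto (fun l : ℕ => (1 : ℝ) - (1 / 2) * (1 / ((l : ℝ) + 1 + 1 / 2))) atTop
        (𝓝 (1 - (1 / 2) * 0)) := by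
      refine Tendsto.const_sub _ (Tendsto.const_mul _ ?_)
      refine squeeze_zero (fun l => by positivity) (fun l => ?_)
        tendsto_one_div_add_atTop_nhds_zero_nat
      apply one_div_le_one_div_of_le <;> first | positivity | linarith
    rw [mul_zero, sub_zero] at h1
    refine h1.congr fun l => ?_
    rw [hh_succ]
    have := (hh_pos l).ne'
    field_simp
    ring
  have ha : ∀ a : ℕ, Tendsto (fun l : ℕ => hh l / hh (l + a)) atTop (𝓝 1) := by
    intro a
    induction a with
    | zero =>
      refine tendsto_const_nhds.congr fun l => ?_
      exact (div_self (hh_pos l).ne').symm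
    | succ a ih =>
      have := ih.mul (hr.comp (tendsto_add_atTop_nat a))
      rw [mul_one] at this
      refine this.congr fun l => ?_
      have e1 := (hh_pos (l + a)).ne'
      simp only [Function.comp]
      rw [show l + (a + 1) = l + a + 1 by omega]
      field_simp
  rw [← tendsto_add_atTop_iff_nat (n + 1)]
  refine (ha (n + 1)).congr fun l => ?_
  unfold uu
  rw [if_pos (by omega), show l + (n + 1) - n - 1 = l by omega]

section chain

set_option linter.unusedSectionVars false

variable {Ω : Type*} [MeasurableSpace Ω] {P : Measure Ω} [IsProbabilityMeasure P]
  {M : ℕ → Ω → ℕ}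

/-- The initial trajectory. -/
def traj (M : ℕ → Ω → ℕ) (t : ℕ) (ω : Ω) : Fin (t + 1) → ℕ := fun i => M i ω

lemma traj_meas (hM : IsPeelingChain P M) (t : ℕ) : Measurable (traj M t) :=
  measurable_pi_lambda _ fun i => hM.1 i

lemma dep_eq {t : ℕ} {A : Set Ω} (hA : Dep M t A) :
    A = traj M t ⁻¹' (traj M t '' A) := by
  apply Set.Subset.antisymm (Set.subset_preimage_image _ _)
  rintro ω ⟨ω', h', he⟩
  refine hA ω' ω (fun i hi => ?_) h'
  exact congrFun he ⟨i, by omega⟩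

lemma dep_meas (hM : IsPeelingChain P M) {t : ℕ} {A : Set Ω} (hA : Dep M t A) :
    MeasurableSet A := by
  rw [dep_eq hA]
  exact traj_meas hM t (Set.to_countable _).measurableSet

lemma cyl (hM : IsPeelingChain P M) (t : ℕ) (h : ℕ → ℕ) (j : ℕ) :
    P ({ω | ∀ i ≤ t, M i ω = h i} ∩ {ω | M (t + 1) ω = j}) =
      ENNReal.ofReal (peelTransition (h t) j) * P {ω | ∀ i ≤ t, M i ω = h i} := by
  have hm : MeasurableSet {ω | ∀ i ≤ t, M i ω = h i} := by
    apply dep_meas hM (t := t)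
    intro ω ω' hh hω i hi
    rw [← hh i hi]; exact hω i hi
  by_cases h0 : P {ω | ∀ i ≤ t, M i ω = h i} = 0
  · rw [h0, mul_zero]
    exact measure_mono_null Set.inter_subset_left h0
  · rw [← hM.2 t h h0 j, cond_mul_eq_inter hm]

lemma markov_one (hM : IsPeelingChain P M) (t : ℕ) {A : Set Ω} (hA : Dep M t A) (j : ℕ) :
    P (A ∩ {ω | M (t + 1) ω = j}) =
      ∫⁻ ω in A, ENNReal.ofReal (peelTransition (M t ω) j) ∂P := by
  have hX := traj_meas hM t
  have hj : MeasurableSet {ω | M (t + 1) ω = j} := hM.1 (t + 1) (measurableSet_singleton j)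
  have key : (P.restrict {ω | M (t + 1) ω = j}).map (traj M t) =
      (P.map (traj M t)).withDensity
        (fun a => ENNReal.ofReal (peelTransition (a (Fin.last t)) j)) := by
    apply Measure.ext_of_singleton
    intro a
    rw [Measure.map_apply hX (measurableSet_singleton a), withDensity_apply _ (measurableSet_singleton a),
      Measure.restrict_apply (hX (measurableSet_singleton a)), lintegral_singleton,
      Measure.map_apply hX (measurableSet_singleton a)]
    have hc : traj M t ⁻¹' {a} =
        {ω | ∀ i ≤ t, M i ω = (fun i => if hi : i < t + 1 then a ⟨i, hi⟩ else 0) i} := by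
      ext ω
      simp only [Set.mem_preimage, Set.mem_singleton_iff, Set.mem_ofPred_eq, funext_iff, traj]
      constructor
      · intro H i hi
        rw [dif_pos (by omega)]
        exact H ⟨i, by omega⟩
      · intro H i
        have := H i (by omega)
        rwa [dif_pos i.2] at this
    rw [hc, cyl hM]
    rw [dif_pos (Nat.lt_succ_self t)]
    rfl
  have hS : MeasurableSet (traj M t '' A) := (Set.to_countable _).measurableSet
  have := congrArg (fun μ => μ (traj M t '' A)) key
  beta_reduce at this
  rw [Measure.map_apply hX hS, withDensity_apply _ hS, ← dep_eq hA,
    Measure.restrict_apply (dep_meas hM hA),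
    setLIntegral_map hS (measurable_of_countable _) hX, ← dep_eq hA] at this
  exact this

lemma markov (hM : IsPeelingChain P M) (t : ℕ) {A : Set Ω} (hA : Dep M t A) (v : ℕ → ℝ≥0∞) :
    ∫⁻ ω in A, v (M (t + 1) ω) ∂P = ∫⁻ ω in A, Kop v (M t ω) ∂P := by
  have hAm := dep_meas hM hA
  rw [← lintegral_map (μ := P.restrict A) (f := v) (measurable_of_countable v) (hM.1 (t + 1)),
    lintegral_countable']
  unfold Kop
  rw [lintegral_tsum]
  · congr 1
    ext j
    rw [lintegral_const_mul (f := fun a => ENNReal.ofReal (peelTransition (M t a) j)) _ ((measurable_of_countable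
      (fun m => ENNReal.ofReal (peelTransition m j))).comp (hM.1 t)), Measure.map_apply (hM.1 _) (measurableSet_singleton j),
      Measure.restrict_apply (hM.1 _ (measurableSet_singleton j)), ← markov_one hM t hA j,
      Set.inter_comm]
    rfl
  · intro j
    exact ((measurable_of_countable (fun m => v j * ENNReal.ofReal (peelTransition m j))).comp
      (hM.1 t)).aemeasurable

lemma climb (hM : IsPeelingChain P M) (h0 : ∀ᵐ ω ∂P, M 0 ω = 0) (t : ℕ) :
    P {ω | ∀ i ≤ t, M i ω = i} ≠ 0 := by
  induction t with
  | zero =>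
    have : P {ω | ∀ i ≤ 0, M i ω = i} = 1 := by
      have h1 : {ω | ∀ i ≤ 0, M i ω = i} =ᵐ[P] (Set.univ : Set Ω) := by
        filter_upwards [h0] with ω hω
        apply propext
        refine ⟨fun _ => trivial, fun _ i hi => ?_⟩
        obtain rfl : i = 0 := by omega
        exact hω
      rw [measure_congr h1, measure_univ]
    rw [this]; exact one_ne_zero
  | succ t ih =>
    have := cyl hM t (fun i => i) (t + 1)
    have h2 : {ω | ∀ i ≤ t + 1, M i ω = i} =
        {ω | ∀ i ≤ t, M i ω = i} ∩ {ω | M (t + 1) ω = t + 1} := by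
      ext ω
      simp only [Set.mem_ofPred_eq, Set.mem_inter_iff]
      constructor
      · exact fun h => ⟨fun i hi => h i (by omega), h _ le_rfl⟩
      · rintro ⟨h, h'⟩ i hi
        rcases Nat.lt_or_ge t i with h3 | h3
        · obtain rfl : i = t + 1 := by omega
          exact h'
        · exact h i h3
    rw [h2, this]
    apply mul_ne_zero _ ih
    rw [ENNReal.ofReal_ne_zero_iff]
    simp only [peelTransition, if_true, pMinusOne]
    positivity

lemma row_sum (hM : IsPeelingChain P M) (h0 : ∀ᵐ ω ∂P, M 0 ω = 0) (m : ℕ) :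
    ∑' j, ENNReal.ofReal (peelTransition m j) = 1 := by
  have hD : Dep M m {ω | ∀ i ≤ m, M i ω = i} := by
    intro ω ω' hh hω i hi
    rw [← hh i hi]; exact hω i hi
  have h1 := markov hM m hD (fun _ => 1)
  have hne := climb hM h0 m
  have h2 : ∫⁻ ω in {ω | ∀ i ≤ m, M i ω = i}, Kop (fun _ => 1) (M m ω) ∂P =
      ∫⁻ ω in {ω | ∀ i ≤ m, M i ω = i}, Kop (fun _ => 1) m ∂P := by
    apply setLIntegral_congr_fun (dep_meas hM hD)
    intro ω hω
    simp only
    rw [hω m le_rfl]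
  rw [h2, lintegral_const, lintegral_const] at h1
  simp only [Measure.restrict_apply_univ] at h1
  have h3 := (ENNReal.mul_left_inj hne (measure_ne_top P _)).1 h1
  rw [h3]
  simp [Kop]

lemma Kop_uu (hM : IsPeelingChain P M) (h0 : ∀ᵐ ω ∂P, M 0 ω = 0) (n m : ℕ) (hm : m ≠ n) :
    Kop (fun j => ENNReal.ofReal (uu n j)) m = ENNReal.ofReal (uu n m) := by
  unfold Kop
  rcases Nat.lt_or_gt_of_ne hm with hlt | hgt
  · have : uu n m = 0 := by rw [uu, if_neg (by omega)]
    rw [this, ENNReal.ofReal_zero, ENNReal.tsum_eq_zero]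
    intro j
    by_cases hj : n < j
    · rw [peelTransition, if_neg (by omega), if_neg (by omega)]; simp
    · have hu : uu n j = 0 := by rw [uu, if_neg hj]
      simp [hu]
  · obtain ⟨l, rfl⟩ : ∃ l, m = l + (n + 1) := ⟨m - (n + 1), by omega⟩
    have hinj : Function.Injective (fun i : ℕ => i + (n + 1)) := fun a b h => by simpa using h
    rw [← hinj.tsum_eq]
    · have : ∀ i : ℕ, ENNReal.ofReal (uu n (i + (n + 1))) *
          ENNReal.ofReal (peelTransition (l + (n + 1)) (i + (n + 1))) =
          ENNReal.ofReal (uu n (l + (n + 1))) * ENNReal.ofReal (peelTransition l i) := by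
        intro i
        rw [← ENNReal.ofReal_mul (uu_nonneg _ _), ← ENNReal.ofReal_mul (uu_nonneg _ _)]
        congr 1
        have := peelTransition_shift l i (n + 1)
        unfold uu
        rw [if_pos (by omega), if_pos (by omega), show i + (n + 1) - n - 1 = i by omega,
          show l + (n + 1) - n - 1 = l by omega]
        have e1 := (hh_pos l).ne'
        have e2 := (hh_pos i).ne'
        have e3 := (hh_pos (l + (n + 1))).ne'
        have e4 := (hh_pos (i + (n + 1))).ne'
        rw [div_eq_div_iff e4 e2] at this
        rw [div_mul_eq_mul_div, div_mul_eq_mul_div, div_eq_div_iff e4 e3]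
        linarith
      simp only [this]
      rw [ENNReal.tsum_mul_left, row_sum hM h0, mul_one]
    · intro j hj
      by_cases h : n < j
      · exact ⟨j - (n + 1), by simp only; omega⟩
      · exfalso; apply hj
        have hu : uu n j = 0 := by rw [uu, if_neg h]
        simp [hu]

lemma Kop_uu_self (n : ℕ) :
    Kop (fun j => ENNReal.ofReal (uu n j)) n = ENNReal.ofReal (1 / visitMean n) := by
  unfold Kop
  rw [tsum_eq_single (n + 1)]
  · rw [← ENNReal.ofReal_mul (uu_nonneg _ _), visitMean_inv]
    congr 1
    simp only [uu, peelTransition, if_true]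
    rw [if_pos (by omega), show n + 1 - n - 1 = 0 by omega, hh_zero]
    ring
  · intro j hj
    by_cases h : n < j
    · rw [peelTransition, if_neg hj, if_neg (by omega)]; simp
    · have hu : uu n j = 0 := by rw [uu, if_neg h]
      simp [hu]

/-- `A` and no visit to `n` at times `t+1, …, t+s`. -/
def GG (M : ℕ → Ω → ℕ) (n t : ℕ) (A : Set Ω) (s : ℕ) : Set Ω :=
  {ω | ω ∈ A ∧ ∀ i, t < i → i ≤ t + s → M i ω ≠ n}

lemma GG_dep {n t : ℕ} {A : Set Ω} (hA : Dep M t A) (s : ℕ) : Dep M (t + s) (GG M n t A s) := by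
  rintro ω ω' he ⟨h1, h2⟩
  refine ⟨hA ω ω' (fun i hi => he i (by omega)) h1, fun i hi hi' => ?_⟩
  rw [← he i hi']
  exact h2 i hi hi'

lemma GG_integral (hM : IsPeelingChain P M) (h0 : ∀ᵐ ω ∂P, M 0 ω = 0) {n t : ℕ} {A : Set Ω}
    (hA : Dep M t A) (hn : ∀ ω ∈ A, M t ω = n) (s : ℕ) :
    ∫⁻ ω in GG M n t A (s + 1), ENNReal.ofReal (uu n (M (t + s + 1) ω)) ∂P =
      ENNReal.ofReal (1 / visitMean n) * P A := by
  have hstep : ∀ s, ∫⁻ ω in GG M n t A (s + 1), ENNReal.ofReal (uu n (M (t + s + 1) ω)) ∂P =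
      ∫⁻ ω in GG M n t A s, ENNReal.ofReal (uu n (M (t + s + 1) ω)) ∂P := by
    intro s
    rw [← lintegral_indicator (dep_meas hM (GG_dep hA _)),
      ← lintegral_indicator (dep_meas hM (GG_dep hA _))]
    congr 1
    ext ω
    by_cases h : M (t + s + 1) ω = n
    · simp [Set.indicator, h, uu_self]
    · have : ω ∈ GG M n t A (s + 1) ↔ ω ∈ GG M n t A s := by
        constructor
        · exact fun H => ⟨H.1, fun i hi hi' => H.2 i hi (by omega)⟩
        · refine fun H => ⟨H.1, fun i hi hi' => ?_⟩
          rcases Nat.lt_or_ge (t + s) i with h3 | h3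
          · obtain rfl : i = t + s + 1 := by omega
            exact h
          · exact H.2 i hi h3
      by_cases hG : ω ∈ GG M n t A s
      · rw [Set.indicator_of_mem hG, Set.indicator_of_mem (this.2 hG)]
      · rw [Set.indicator_of_notMem hG, Set.indicator_of_notMem (fun h' => hG (this.1 h'))]
  induction s with
  | zero =>
    rw [hstep, add_zero]
    have hG : GG M n t A 0 = A := by
      ext ω
      exact ⟨fun h => h.1, fun h => ⟨h, fun i hi hi' => by omega⟩⟩
    rw [hG, markov hM t hA (fun j => ENNReal.ofReal (uu n j)),
      setLIntegral_congr_fun (dep_meas hM hA) (g := fun _ => ENNReal.ofReal (1 / visitMean n)),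
      setLIntegral_const]
    intro ω hω
    simp only
    rw [hn ω hω, Kop_uu_self]
  | succ s ih =>
    rw [hstep, ← ih, markov hM (t + (s + 1)) (GG_dep hA (s + 1)) (fun j => ENNReal.ofReal (uu n j))]
    apply setLIntegral_congr_fun (dep_meas hM (GG_dep hA _))
    intro ω hω
    simp only
    rw [Kop_uu hM h0]
    · rfl
    · exact hω.2 _ (by omega) le_rfl

/-- `A` and no visit to `n` after `t`. -/
def GI (M : ℕ → Ω → ℕ) (n t : ℕ) (A : Set Ω) : Set Ω :=
  {ω | ω ∈ A ∧ ∀ i, t < i → M i ω ≠ n}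

lemma GI_eq (n t : ℕ) (A : Set Ω) : GI M n t A = ⋂ s, GG M n t A (s + 1) := by
  ext ω
  simp only [GI, GG, Set.mem_ofPred_eq, Set.mem_iInter]
  constructor
  · exact fun h s => ⟨h.1, fun i hi _ => h.2 i hi⟩
  · exact fun h => ⟨(h 0).1, fun i hi => (h i).2 i hi (by omega)⟩

lemma GI_meas (hM : IsPeelingChain P M) {n t : ℕ} {A : Set Ω}
    (hA : Dep M t A) : MeasurableSet (GI M n t A) := by
  rw [GI_eq]
  exact MeasurableSet.iInter fun s => dep_meas hM (GG_dep hA _)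

lemma GI_lower (hM : IsPeelingChain P M) (h0 : ∀ᵐ ω ∂P, M 0 ω = 0) {n t : ℕ} {A : Set Ω}
    (hA : Dep M t A) (hn : ∀ ω ∈ A, M t ω = n) :
    ENNReal.ofReal (1 / visitMean n) * P A ≤ P (GI M n t A) := by
  have hanti : Antitone (fun s => GG M n t A (s + 1)) := by
    intro s s' hs ω hω
    exact ⟨hω.1, fun i hi hi' => hω.2 i hi (by omega)⟩
  rw [GI_eq]
  refine ge_of_tendsto (tendsto_measure_iInter_atTop
    (fun s => (dep_meas hM (GG_dep hA _)).nullMeasurableSet) hanti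
    ⟨0, measure_ne_top _ _⟩) (Eventually.of_forall fun s => ?_)
  simp only [Function.comp]
  rw [← GG_integral hM h0 hA hn s, ← setLIntegral_one]
  apply lintegral_mono
  intro ω
  exact ENNReal.ofReal_le_one.2 (uu_le_one _ _)

lemma visitMean_inv_pos (n : ℕ) : 0 < 1 / visitMean n := by
  rw [visitMean_inv]
  apply div_pos _ (hh_pos _)
  unfold pMinusOne
  positivity

lemma visitMean_inv_le (n : ℕ) : 1 / visitMean n ≤ 1 := by
  rw [visitMean_inv, div_le_one (hh_pos _)]
  have h1 : pMinusOne n ≤ 1 := by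
    unfold pMinusOne
    rw [div_le_one (by positivity)]
    have : (0 : ℝ) ≤ n := by positivity
    linarith
  have := hh_mono (Nat.zero_le (n + 1))
  rw [hh_zero] at this
  linarith

lemma dep_visit (n t : ℕ) : Dep M t {ω | M t ω = n} := by
  intro ω ω' h hω
  simp only [Set.mem_ofPred_eq] at hω ⊢
  rw [← h t le_rfl, hω]

lemma finite_visits (hM : IsPeelingChain P M) (h0 : ∀ᵐ ω ∂P, M 0 ω = 0) (n : ℕ) :
    ∀ᵐ ω ∂P, {t : ℕ | M t ω = n}.Finite := by
  have hdisj : Pairwise (Function.onFun Disjoint (fun t => GI M n t {ω | M t ω = n})) := by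
    intro s t hst
    rw [Function.onFun, Set.disjoint_left]
    rintro ω ⟨h1, h2⟩ ⟨h3, h4⟩
    rcases Nat.lt_or_gt_of_ne hst with h | h
    · exact h2 t h h3
    · exact h4 s h h1
  have h1 : ENNReal.ofReal (1 / visitMean n) * ∑' t, P {ω | M t ω = n} ≤ 1 := by
    rw [← ENNReal.tsum_mul_left]
    calc _ ≤ ∑' t, P (GI M n t {ω | M t ω = n}) :=
          ENNReal.tsum_le_tsum fun t => GI_lower hM h0 (dep_visit n t) (fun ω h => h)
      _ = P (⋃ t, GI M n t {ω | M t ω = n}) :=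
          (measure_iUnion hdisj fun t => GI_meas hM (dep_visit n t)).symm
      _ ≤ 1 := prob_le_one
  apply ae_finite_setOfPred_mem (s := fun t => {ω | M t ω = n})
  intro htop
  rw [htop, ENNReal.mul_top] at h1
  · simp at h1
  · rw [ENNReal.ofReal_ne_zero_iff]; exact visitMean_inv_pos n

lemma tends (hM : IsPeelingChain P M) (h0 : ∀ᵐ ω ∂P, M 0 ω = 0) :
    ∀ᵐ ω ∂P, Tendsto (fun t => M t ω) atTop atTop := by
  filter_upwards [ae_all_iff.2 fun n => finite_visits hM h0 n] with ω h
  rw [← Nat.cofinite_eq_atTop]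
  apply Tendsto.cofinite_of_finite_preimage_singleton
  exact h

lemma up_step (hM : IsPeelingChain P M) : ∀ᵐ ω ∂P, ∀ t, M (t + 1) ω ≤ M t ω + 1 := by
  rw [ae_all_iff]
  intro t
  have : ∀ m j, m + 1 < j → P ({ω | M t ω = m} ∩ {ω | M (t + 1) ω = j}) = 0 := by
    intro m j hmj
    rw [markov_one hM t (dep_visit m t) j,
      setLIntegral_congr_fun (dep_meas hM (dep_visit m t)) (g := fun _ => 0)]
    · simp
    · intro ω hω
      simp only [Set.mem_ofPred_eq] at hω
      simp only
      rw [hω, peelTransition, if_neg (by omega), if_neg (by omega)]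
      simp
  have h2 : ∀ᵐ ω ∂P, ∀ m j, m + 1 < j → ¬ (M t ω = m ∧ M (t + 1) ω = j) := by
    simp only [ae_all_iff]
    intro m j hmj
    rw [ae_iff]
    simpa [Set.inter_def] using this m j hmj
  filter_upwards [h2] with ω h
  by_contra hc
  exact h _ _ (by omega) ⟨rfl, rfl⟩

lemma nonempty_visits (hM : IsPeelingChain P M) (h0 : ∀ᵐ ω ∂P, M 0 ω = 0) (n : ℕ) :
    ∀ᵐ ω ∂P, {t : ℕ | M t ω = n}.Nonempty := by
  filter_upwards [h0, up_step hM, tends hM h0] with ω h1 h2 h3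
  have hex : ∃ t, n ≤ M t ω := (h3.eventually_ge_atTop n).exists
  classical
  refine ⟨Nat.find hex, ?_⟩
  have hf := Nat.find_spec hex
  rcases Nat.eq_zero_or_eq_succ_pred (Nat.find hex) with h | h
  · rw [h, h1] at hf
    simp only [Set.mem_ofPred_eq]
    rw [h, h1]; omega
  · have h4 := Nat.find_min hex (m := (Nat.find hex).pred) (by omega)
    have h5 := h2 (Nat.find hex).pred
    rw [← Nat.succ_eq_add_one, ← h] at h5
    simp only [Set.mem_ofPred_eq]
    omega

lemma GI_measure (hM : IsPeelingChain P M) (h0 : ∀ᵐ ω ∂P, M 0 ω = 0) {n t : ℕ} {A : Set Ω}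
    (hA : Dep M t A) (hn : ∀ ω ∈ A, M t ω = n) :
    P (GI M n t A) = ENNReal.ofReal (1 / visitMean n) * P A := by
  have hlim : Tendsto (fun s => ∫⁻ ω, (GG M n t A (s + 1)).indicator
      (fun ω => ENNReal.ofReal (uu n (M (t + s + 1) ω))) ω ∂P) atTop
      (𝓝 (∫⁻ ω, (GI M n t A).indicator (fun _ => 1) ω ∂P)) := by
    apply tendsto_lintegral_of_dominated_convergence (fun _ => 1)
    · intro s
      refine Measurable.indicator ?_ (dep_meas hM (GG_dep hA _))
      exact (measurable_of_countable (fun m => ENNReal.ofReal (uu n m))).comp (hM.1 _)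
    · intro s
      refine Eventually.of_forall fun ω => ?_
      by_cases hG : ω ∈ GG M n t A (s + 1)
      · rw [Set.indicator_of_mem hG]
        exact ENNReal.ofReal_le_one.2 (uu_le_one _ _)
      · rw [Set.indicator_of_notMem hG]
        exact zero_le_one
    · simp
    · filter_upwards [tends hM h0] with ω hω
      by_cases hG : ω ∈ GI M n t A
      · rw [Set.indicator_of_mem hG]
        have : ∀ s, ω ∈ GG M n t A (s + 1) := by
          rw [GI_eq] at hG; exact Set.mem_iInter.1 hG
        simp only [fun s => Set.indicator_of_mem (this s) (fun ω => ENNReal.ofReal (uu n (M (t + s + 1) ω)))]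
        have h1 : Tendsto (fun s => M (t + s + 1) ω) atTop atTop := by
          refine hω.comp (tendsto_atTop_mono (fun s => ?_) tendsto_id)
          simp only [id]; omega
        have := ENNReal.tendsto_ofReal ((uu_tendsto n).comp h1)
        rwa [ENNReal.ofReal_one] at this
      · rw [Set.indicator_of_notMem hG]
        rw [GI_eq, Set.mem_iInter, not_forall] at hG
        obtain ⟨s0, hs0⟩ := hG
        apply tendsto_const_nhds.congr'
        filter_upwards [eventually_ge_atTop s0] with s hs
        have hs1 : ω ∉ GG M n t A (s + 1) :=
          fun hω => hs0 ⟨hω.1, fun i hi hi' => hω.2 i hi (by omega)⟩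
        rw [Set.indicator_of_notMem hs1]
  simp only [lintegral_indicator (dep_meas hM (GG_dep hA _)), GG_integral hM h0 hA hn,
    lintegral_indicator (GI_meas hM hA), setLIntegral_one] at hlim
  exact tendsto_nhds_unique hlim tendsto_const_nhds 

open Classical in
/-- The `(j+1)`-st visit to `n` happens at time `t`. -/
def BB (M : ℕ → Ω → ℕ) (n j t : ℕ) : Set Ω :=
  {ω | M t ω = n ∧ Nat.count (fun i => M i ω = n) t = j}

lemma BB_dep (n j t : ℕ) : Dep M t (BB M n j t) := by
  classical
  rintro ω ω' h ⟨h1, h2⟩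
  refine ⟨by rw [← h t le_rfl, h1], ?_⟩
  rw [← h2, Nat.count_eq_card_filter_range, Nat.count_eq_card_filter_range]
  congr 1
  apply Finset.filter_congr
  intro i hi
  rw [h i (Finset.mem_range.1 hi).le]

lemma BB_disj (n j : ℕ) : Pairwise (Function.onFun Disjoint (BB M n j)) := by
  classical
  intro s t hst
  rw [Function.onFun, Set.disjoint_left]
  rintro ω ⟨h1, h2⟩ ⟨h3, h4⟩
  exact hst (Nat.count_injective (p := fun i => M i ω = n) h1 h3 (h2.trans h4.symm))

lemma count_le_ncard {S : Set ℕ} (hS : S.Finite) [DecidablePred (· ∈ S)] (t : ℕ) :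
    Nat.count (· ∈ S) t ≤ S.ncard := by
  rw [Nat.count_eq_card_filter_range, ← Set.ncard_coe_finset]
  apply Set.ncard_le_ncard _ hS
  intro x hx
  simpa using (Finset.mem_filter.1 (Finset.mem_coe.1 hx)).2

lemma exists_count {S : Set ℕ} (hS : S.Finite) [DecidablePred (· ∈ S)] (j : ℕ) (hj : j < S.ncard) :
    ∃ t ∈ S, Nat.count (· ∈ S) t = j := by
  have hj' : ∀ hf : (Set.ofPred (· ∈ S)).Finite, j < hf.toFinset.card := by
    intro hf
    rwa [Set.ncard_eq_toFinset_card S hS] at hj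
  exact ⟨Nat.nth (· ∈ S) j, Nat.nth_mem j hj', Nat.count_nth hj'⟩

lemma count_last {S : Set ℕ} [DecidablePred (· ∈ S)] (t : ℕ) (ht : t ∈ S) (hl : ∀ i, t < i → i ∉ S) :
    S.ncard = Nat.count (· ∈ S) t + 1 := by
  have h1 : Nat.count (· ∈ S) (t + 1) = Nat.count (· ∈ S) t + 1 := by
    rw [Nat.count_succ, if_pos ht]
  rw [← h1, Nat.count_eq_card_filter_range, ← Set.ncard_coe_finset]
  congr 1
  ext x
  simp only [Finset.coe_filter, Finset.mem_range, Set.mem_ofPred_eq]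
  constructor
  · intro hx
    refine ⟨?_, hx⟩
    by_contra hc
    exact hl x (by omega) hx
  · exact fun h => h.2

lemma union_BB (n j : ℕ) (ω : Ω) (hf : {t : ℕ | M t ω = n}.Finite) :
    ω ∈ (⋃ t, BB M n j t) ↔ j < {t : ℕ | M t ω = n}.ncard := by
  classical
  rw [Set.mem_iUnion]
  constructor
  · rintro ⟨t, h1, h2⟩
    have := count_le_ncard hf (t + 1)
    rw [Nat.count_succ, if_pos (by exact h1)] at this
    have h3 : Nat.count (· ∈ {t : ℕ | M t ω = n}) t = j := by
      rw [← h2]; congr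
    omega
  · intro h
    obtain ⟨t, h1, h2⟩ := exists_count hf j h
    refine ⟨t, h1, ?_⟩
    rw [← h2]; congr

lemma union_GI (n j : ℕ) (ω : Ω) :
    ω ∈ (⋃ t, GI M n t (BB M n j t)) ↔ {t : ℕ | M t ω = n}.ncard = j + 1 := by
  classical
  rw [Set.mem_iUnion]
  constructor
  · rintro ⟨t, ⟨h1, h2⟩, h3⟩
    rw [count_last (S := {t : ℕ | M t ω = n}) t h1 h3, ← h2]
    congr
  · intro h
    have hf : {t : ℕ | M t ω = n}.Finite := Set.finite_of_ncard_ne_zero (by omega)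
    obtain ⟨t, h1, h2⟩ := exists_count hf j (by omega)
    refine ⟨t, ⟨h1, ?_⟩, ?_⟩
    · rw [← h2]; congr
    · intro s hs hs'
      have e1 := count_le_ncard hf (s + 1)
      rw [Nat.count_succ, if_pos (by exact hs')] at e1
      have e2 := Nat.count_monotone (· ∈ {t : ℕ | M t ω = n}) (show t + 1 ≤ s from hs)
      rw [Nat.count_succ, if_pos h1] at e2
      omega

lemma visits_eq (hM : IsPeelingChain P M) (h0 : ∀ᵐ ω ∂P, M 0 ω = 0) (n j : ℕ) :
    P {ω | {t : ℕ | M t ω = n}.ncard = j + 1} =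
      ENNReal.ofReal (1 / visitMean n) * P {ω | j < {t : ℕ | M t ω = n}.ncard} := by
  have h1 : {ω | {t : ℕ | M t ω = n}.ncard = j + 1} = ⋃ t, GI M n t (BB M n j t) := by
    ext ω; exact (union_GI n j ω).symm
  have h2 : P {ω | j < {t : ℕ | M t ω = n}.ncard} = P (⋃ t, BB M n j t) := by
    apply measure_congr
    filter_upwards [finite_visits hM h0 n] with ω hf
    exact propext (union_BB n j ω hf).symm
  rw [h1, h2, measure_iUnion _ fun t => GI_meas hM (BB_dep n j t),
    measure_iUnion (BB_disj n j) fun t => dep_meas hM (BB_dep n j t), ← ENNReal.tsum_mul_left]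
  · congr 1
    ext t
    exact GI_measure hM h0 (BB_dep n j t) fun ω h => h.1
  · intro s t hst
    exact (BB_disj n j hst).mono (fun ω h => h.1) (fun ω h => h.1)

lemma ncard_meas (hM : IsPeelingChain P M) (n j : ℕ) :
    MeasurableSet {ω | {t : ℕ | M t ω = n}.ncard = j + 1} := by
  have h1 : {ω | {t : ℕ | M t ω = n}.ncard = j + 1} = ⋃ t, GI M n t (BB M n j t) := by
    ext ω; exact (union_GI n j ω).symm
  rw [h1]
  exact MeasurableSet.iUnion fun t => GI_meas hM (BB_dep n j t)

lemma visits_gt (hM : IsPeelingChain P M) (h0 : ∀ᵐ ω ∂P, M 0 ω = 0) (n j : ℕ) :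
    P {ω | j < {t : ℕ | M t ω = n}.ncard} = ENNReal.ofReal ((1 - 1 / visitMean n) ^ j) := by
  have e0 := visitMean_inv_pos n
  have e1 := visitMean_inv_le n
  induction j with
  | zero =>
    rw [pow_zero, ENNReal.ofReal_one]
    have : {ω | 0 < {t : ℕ | M t ω = n}.ncard} =ᵐ[P] (Set.univ : Set Ω) := by
      filter_upwards [finite_visits hM h0 n, nonempty_visits hM h0 n] with ω hf hn
      apply propext
      exact ⟨fun _ => trivial, fun _ => (Set.ncard_pos hf).2 hn⟩
    rw [measure_congr this, measure_univ]
  | succ j ih =>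
    have hd : {ω | j + 1 < {t : ℕ | M t ω = n}.ncard} =
        {ω | j < {t : ℕ | M t ω = n}.ncard} \ {ω | {t : ℕ | M t ω = n}.ncard = j + 1} := by
      ext ω
      simp only [Set.mem_ofPred_eq, Set.mem_sdiff]
      omega
    rw [hd, measure_sdiff _ (ncard_meas hM n j).nullMeasurableSet (measure_ne_top _ _),
      visits_eq hM h0, ih, ← ENNReal.ofReal_mul e0.le, ← ENNReal.ofReal_sub]
    · congr 1
      ring
    · exact mul_nonneg e0.le (pow_nonneg (by linarith) _)
    · intro ω hω
      simp only [Set.mem_ofPred_eq] at hω ⊢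
      omega

end chain

/-- For a peeling Markov chain started from `0`, the number of visits to `n` is a.s.
finite and at least `1`, and is a geometric random variable on `{1,2,…}` with mean
`μ_n = ((3n+3)/(2n+3)) (n+3/2)_{n+1}/(n+1)!`:
for every `j ≥ 1`, `P(#visits = j) = (1/μ_n)(1 - 1/μ_n)^{j-1}`. -/
theorem peeling_chain_visits_geometric {Ω : Type*} [MeasurableSpace Ω] (P : Measure Ω)
    [IsProbabilityMeasure P] (M : ℕ → Ω → ℕ) (hM : IsPeelingChain P M)
    (h0 : ∀ᵐ ω ∂P, M 0 ω = 0) (n : ℕ) :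
    (∀ᵐ ω ∂P, {t : ℕ | M t ω = n}.Finite ∧ {t : ℕ | M t ω = n}.Nonempty) ∧
    (∀ j : ℕ, 1 ≤ j →
      P {ω | {t : ℕ | M t ω = n}.ncard = j} =
        ENNReal.ofReal ((1 / visitMean n) * (1 - 1 / visitMean n) ^ (j - 1))) := by
  refine ⟨?_, ?_⟩
  · filter_upwards [finite_visits hM h0 n, nonempty_visits hM h0 n] with ω h1 h2
    exact ⟨h1, h2⟩
  · intro j hj
    obtain ⟨k, rfl⟩ : ∃ k, j = k + 1 := ⟨j - 1, by omega⟩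
    rw [visits_eq hM h0, visits_gt hM h0, ← ENNReal.ofReal_mul (visitMean_inv_pos n).le,
      Nat.add_sub_cancel]
end

section
/- For every integer m ≥ 0, the expected number of internal vertices of a free triangulation of an (m+2)-gon equals (m+1)(2m+1)/3; that is, (Σ_{n=0}^∞ n φ_{n,m} (2/27)^n) / (Σ_{n=0}^∞ φ_{n,m} (2/27)^n) = (m+1)(2m+1)/3, both series being convergent. -/
/-- `φ_{n,m}`: the number of rooted type II triangulations of a disc with `m+2`
boundary vertices and `n` internal vertices. -/
noncomputable def phi (n m : ℕ) : ℝ :=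
  2 ^ (n + 1) * ((2 * m + 1).factorial : ℝ) * ((2 * m + 3 * n).factorial : ℝ) /
    (((m.factorial : ℝ)) ^ 2 * ((n.factorial : ℝ)) * (((2 * m + 2 * n + 2).factorial : ℝ)))

/-- Fuss-Catalan (Raney) numbers, defined by their recursion. -/
noncomputable def raney : ℕ → ℕ → ℝ
  | 0, _ => 1
  | _ + 1, 0 => 0
  | n + 1, r + 1 => raney (n + 1) r + raney n (r + 3)

lemma raney_formula (n : ℕ) : ∀ r : ℕ, raney n (r + 1) =
    ((r : ℝ) + 1) * ((3 * n + r).factorial : ℝ) /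
      ((n.factorial : ℝ) * ((2 * n + r + 1).factorial : ℝ)) := by
  induction n with
  | zero =>
    intro r
    have h : ((r.factorial : ℕ) : ℝ) ≠ 0 := by positivity
    have h1 : (r : ℝ) + 1 ≠ 0 := by positivity
    simp [raney, Nat.factorial_succ]
    field_simp
  | succ n ih =>
    intro r
    induction r with
    | zero =>
      rw [raney, raney, ih 2]
      have e1 : 3 * (n + 1) + 0 = (3 * n + 2) + 1 := by ring
      have e2 : 2 * (n + 1) + 0 + 1 = 2 * n + 2 + 1 := by ring
      rw [e1, e2, Nat.factorial_succ (3 * n + 2), Nat.factorial_succ n]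
      push_cast
      field_simp
      ring
    | succ r ihr =>
      rw [raney, ihr, ih (r + 3)]
      have e1 : 3 * (n + 1) + (r + 1) = (3 * n + r + 3) + 1 := by ring
      have e2 : 2 * (n + 1) + (r + 1) + 1 = (2 * n + r + 3) + 1 := by ring
      have e3 : 3 * (n + 1) + r = 3 * n + r + 3 := by ring
      have e4 : 2 * (n + 1) + r + 1 = 2 * n + r + 3 := by ring
      have e5 : 3 * n + (r + 3) = 3 * n + r + 3 := by ring
      have e6 : 2 * n + (r + 3) + 1 = (2 * n + r + 3) + 1 := by ring
      rw [e1, e2, e3, e4, e5, e6, Nat.factorial_succ (3 * n + r + 3),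
        Nat.factorial_succ (2 * n + r + 3), Nat.factorial_succ n]
      push_cast
      field_simp
      ring

lemma raney_nonneg (n : ℕ) : ∀ r : ℕ, 0 ≤ raney n r := by
  intro r
  cases r with
  | zero => cases n <;> simp [raney]
  | succ r => rw [raney_formula]; positivity

lemma raney_partial_rec (N r : ℕ) :
    ∑ n ∈ Finset.range (N + 1), raney n (r + 1) * (4 / 27 : ℝ) ^ n =
    ∑ n ∈ Finset.range (N + 1), raney n r * (4 / 27 : ℝ) ^ n +
    4 / 27 * ∑ n ∈ Finset.range N, raney n (r + 3) * (4 / 27 : ℝ) ^ n := by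
  rw [Finset.sum_range_succ', Finset.sum_range_succ', Finset.mul_sum]
  have : ∀ n, raney (n + 1) (r + 1) * (4 / 27 : ℝ) ^ (n + 1) =
      raney (n + 1) r * (4 / 27 : ℝ) ^ (n + 1) +
      4 / 27 * (raney n (r + 3) * (4 / 27 : ℝ) ^ n) := by
    intro n; rw [raney]; ring
  rw [Finset.sum_congr rfl (fun n _ => this n), Finset.sum_add_distrib]
  simp only [raney]
  ring

lemma raney_partial_le (N : ℕ) : ∀ r : ℕ,
    ∑ n ∈ Finset.range N, raney n r * (4 / 27 : ℝ) ^ n ≤ (3 / 2 : ℝ) ^ r := by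
  induction N with
  | zero => intro r; simp; positivity
  | succ N ih =>
    intro r
    induction r with
    | zero => rw [Finset.sum_range_succ']; simp [raney]
    | succ r ihr =>
      rw [raney_partial_rec]
      have h := ih (r + 3)
      have e : (3 / 2 : ℝ) ^ (r + 3) = 27 / 8 * (3 / 2 : ℝ) ^ r := by ring
      have e' : (3 / 2 : ℝ) ^ (r + 1) = 3 / 2 * (3 / 2 : ℝ) ^ r := by ring
      rw [e] at h
      rw [e']
      linarith

lemma raney_term_nonneg (r n : ℕ) : 0 ≤ raney n r * (4 / 27 : ℝ) ^ n :=
  mul_nonneg (raney_nonneg n r) (by positivity)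

lemma raney_summable (r : ℕ) : Summable (fun n => raney n r * (4 / 27 : ℝ) ^ n) :=
  summable_of_sum_range_le (raney_term_nonneg r) (fun N => raney_partial_le N r)

noncomputable def rgen (r : ℕ) : ℝ := ∑' n, raney n r * (4 / 27 : ℝ) ^ n

lemma rgen_le (r : ℕ) : rgen r ≤ (3 / 2 : ℝ) ^ r :=
  Real.tsum_le_of_sum_range_le (raney_term_nonneg r) (fun N => raney_partial_le N r)

lemma rgen_nonneg (r : ℕ) : 0 ≤ rgen r := tsum_nonneg (raney_term_nonneg r)

lemma rgen_zero : rgen 0 = 1 := by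
  unfold rgen
  rw [tsum_eq_single 0]
  · simp [raney]
  · intro n hn
    cases n with
    | zero => exact absurd rfl hn
    | succ n => simp [raney]

lemma rgen_rec (r : ℕ) : rgen (r + 1) = rgen r + 4 / 27 * rgen (r + 3) := by
  unfold rgen
  rw [(raney_summable (r + 1)).tsum_eq_zero_add, (raney_summable r).tsum_eq_zero_add,
    ← tsum_mul_left]
  have : ∀ n, raney (n + 1) (r + 1) * (4 / 27 : ℝ) ^ (n + 1) =
      raney (n + 1) r * (4 / 27 : ℝ) ^ (n + 1) +
      4 / 27 * (raney n (r + 3) * (4 / 27 : ℝ) ^ n) := by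
    intro n; rw [raney]; ring
  simp only [this]
  rw [Summable.tsum_add ((summable_nat_add_iff 1).2 (raney_summable r))
    ((raney_summable (r + 3)).mul_left _)]
  simp only [raney]
  ring

/-- A bounded solution of the harmonic recursion is constant. -/
lemma harmonic_const (P : ℕ → ℝ) (h0 : ∀ r, 0 ≤ P r) (h1 : ∀ r, P r ≤ 1)
    (hrec : ∀ r, 3 * P (r + 1) = 2 * P r + P (r + 3)) : ∀ r, P r = P 0 := by
  have hE : ∀ r, P (r + 2) - 2 * P (r + 1) + P r = (-2) ^ r * (P 2 - 2 * P 1 + P 0) := by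
    intro r
    induction r with
    | zero => simp
    | succ r ih =>
      rw [pow_succ, mul_right_comm, ← ih]
      have := hrec r
      rw [show r + 1 + 2 = r + 3 by ring, show r + 1 + 1 = r + 2 by ring]
      linarith
  have hz : P 2 - 2 * P 1 + P 0 = 0 := by
    by_contra hne
    have hpos : 0 < |P 2 - 2 * P 1 + P 0| := abs_pos.2 hne
    obtain ⟨k, hk⟩ := pow_unbounded_of_one_lt (4 / |P 2 - 2 * P 1 + P 0|)
      (by norm_num : (1 : ℝ) < 2)
    rw [div_lt_iff₀ hpos] at hk
    have hb : |P (k + 2) - 2 * P (k + 1) + P k| ≤ 4 := by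
      rw [abs_le]
      constructor <;> linarith [h0 k, h0 (k + 1), h0 (k + 2), h1 k, h1 (k + 1), h1 (k + 2)]
    rw [hE k, abs_mul, abs_pow, abs_neg, abs_two] at hb
    linarith
  have hL : ∀ r : ℕ, P r = P 0 + r * (P 1 - P 0) ∧
      P (r + 1) = P 0 + (r + 1) * (P 1 - P 0) := by
    intro r
    induction r with
    | zero => simp
    | succ r ih =>
      refine ⟨by push_cast; exact ih.2, ?_⟩
      have := hE r
      rw [hz, mul_zero] at this
      rw [show r + 1 + 1 = r + 2 by ring]
      push_cast
      linarith [ih.1, ih.2]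
  have hd : P 1 - P 0 = 0 := by
    by_contra hne
    have hpos : 0 < |P 1 - P 0| := abs_pos.2 hne
    obtain ⟨k, hk⟩ := exists_nat_gt (1 / |P 1 - P 0|)
    rw [div_lt_iff₀ hpos] at hk
    have hb : |(k : ℝ) * (P 1 - P 0)| ≤ 1 := by
      have := (hL k).1
      rw [abs_le]
      constructor <;> linarith [h0 k, h0 0, h1 k, h1 0]
    rw [abs_mul, Nat.abs_cast] at hb
    linarith
  intro r
  rw [(hL r).1, hd]
  ring

lemma rgen_eq (r : ℕ) : rgen r = (3 / 2 : ℝ) ^ r := by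
  have h := harmonic_const (fun r => rgen r * (2 / 3 : ℝ) ^ r)
    (fun r => mul_nonneg (rgen_nonneg r) (by positivity))
    (fun r => by
      calc rgen r * (2 / 3 : ℝ) ^ r ≤ (3 / 2 : ℝ) ^ r * (2 / 3 : ℝ) ^ r := by
            gcongr; exact rgen_le r
        _ = 1 := by rw [← mul_pow]; norm_num)
    (fun r => by
      have := rgen_rec r
      simp only [this, pow_succ]
      ring) r
  simp only [rgen_zero, pow_zero, mul_one] at h
  have h2 : (3 / 2 : ℝ) ^ r * (2 / 3 : ℝ) ^ r = 1 := by rw [← mul_pow]; norm_num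
  have h3 : (2 / 3 : ℝ) ^ r ≠ 0 := by positivity
  exact mul_right_cancel₀ h3 (h.trans h2.symm)

lemma raney_hasSum (r : ℕ) :
    HasSum (fun n => raney n r * (4 / 27 : ℝ) ^ n) ((3 / 2 : ℝ) ^ r) := by
  rw [← rgen_eq r]
  exact (raney_summable r).hasSum

/-- Prefactor of `phi`. -/
noncomputable def pref (m : ℕ) : ℝ := 2 * ((2 * m + 1).factorial : ℝ) / (m.factorial : ℝ) ^ 2

lemma phi_raney_one (n m : ℕ) :
    (2 * (n : ℝ) + 2 * m + 2) * phi n m =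
      pref m / (2 * m + 1) * (2 ^ n * raney n (2 * m + 1)) := by
  rw [raney_formula, phi, pref, Nat.add_comm (2 * m) (3 * n),
    show 2 * m + 2 * n + 2 = (2 * n + 2 * m + 1) + 1 by ring,
    Nat.factorial_succ (2 * n + 2 * m + 1)]
  push_cast
  field_simp
  ring

lemma phi_raney_two (n m : ℕ) :
    (3 * (n : ℝ) + 2 * m + 1) * phi n m =
      pref m / (2 * m + 2) * (2 ^ n * raney n (2 * m + 2)) := by
  rw [raney_formula n (2 * m + 1), phi, pref, Nat.add_comm (2 * m) (3 * n),
    show 2 * m + 2 * n + 2 = 2 * n + (2 * m + 1) + 1 by ring,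
    show 3 * n + (2 * m + 1) = (3 * n + 2 * m) + 1 by ring,
    Nat.factorial_succ (3 * n + 2 * m)]
  push_cast
  field_simp
  ring

lemma pow_split (n : ℕ) : (4 / 27 : ℝ) ^ n = 2 ^ n * (2 / 27) ^ n := by
  rw [← mul_pow]; norm_num

lemma phi_hasSum (m : ℕ) : HasSum (fun n : ℕ => phi n m * (2 / 27) ^ n)
    (pref m * (3 / 2 : ℝ) ^ (2 * m + 2) / ((m + 2) * (2 * m + 1) * (2 * m + 2))) := by
  have h := (((raney_hasSum (2 * m + 1)).mul_left (3 / 2 * (pref m / (2 * m + 1)))).sub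
    ((raney_hasSum (2 * m + 2)).mul_left (pref m / (2 * m + 2)))).mul_left (1 / ((m : ℝ) + 2))
  convert h using 1
  · rfl
  · funext n
    have a := phi_raney_one n m
    have b := phi_raney_two n m
    have h2 : ((m : ℝ) + 2) * phi n m = 3 / 2 * (pref m / (2 * m + 1) *
        (2 ^ n * raney n (2 * m + 1))) - pref m / (2 * m + 2) * (2 ^ n * raney n (2 * m + 2)) := by
      rw [← a, ← b]; ring
    have hm : (m : ℝ) + 2 ≠ 0 := by positivity
    rw [pow_split, one_div, eq_inv_mul_iff_mul_eq₀ hm, ← mul_assoc, h2]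
    ring
  · rw [pow_succ (3 / 2 : ℝ) (2 * m + 1)]
    field_simp
    ring

lemma n_phi_hasSum (m : ℕ) : HasSum (fun n : ℕ => (n : ℝ) * phi n m * (2 / 27) ^ n)
    ((((m : ℝ) + 1) * (2 * m + 1) / 3) *
      (pref m * (3 / 2 : ℝ) ^ (2 * m + 2) / ((m + 2) * (2 * m + 1) * (2 * m + 2)))) := by
  have h := (((raney_hasSum (2 * m + 1)).mul_left (pref m / (2 * m + 1))).sub
    ((phi_hasSum m).mul_left (2 * (m : ℝ) + 2))).mul_left (1 / 2 : ℝ)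
  convert h using 1
  · rfl
  · funext n
    have a := phi_raney_one n m
    have h2 : (n : ℝ) * phi n m = 1 / 2 * (pref m / (2 * m + 1) *
        (2 ^ n * raney n (2 * m + 1)) - (2 * m + 2) * phi n m) := by
      rw [← a]; ring
    rw [pow_split, h2]
    ring
  · rw [pow_succ (3 / 2 : ℝ) (2 * m + 1)]
    field_simp
    ring

/-- The expected number of internal vertices of a free triangulation of an
`(m+2)`-gon equals `(m+1)(2m+1)/3`:
`(Σ_n n φ_{n,m} (2/27)^n)/(Σ_n φ_{n,m} (2/27)^n) = (m+1)(2m+1)/3`,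
both series being convergent. -/
theorem free_triangulation_mean_size (m : ℕ) :
    Summable (fun n : ℕ => phi n m * (2 / 27) ^ n) ∧
    Summable (fun n : ℕ => (n : ℝ) * phi n m * (2 / 27) ^ n) ∧
    (∑' n : ℕ, (n : ℝ) * phi n m * (2 / 27) ^ n) / (∑' n : ℕ, phi n m * (2 / 27) ^ n) =
      ((m : ℝ) + 1) * (2 * (m : ℝ) + 1) / 3 := by
  refine ⟨(phi_hasSum m).summable, (n_phi_hasSum m).summable, ?_⟩
  rw [(phi_hasSum m).tsum_eq, (n_phi_hasSum m).tsum_eq]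
  apply mul_div_cancel_right₀
  have : 0 < pref m := by unfold pref; positivity
  positivity
end
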